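/- Let n ≥ 3 be an integer and let K be a continuum homeomorphic to the inverse limit lim←(X_i, Φ_i), where each X_i is a simple-n-od graph and each Φ_i : X_{i+1} → X_i is a surjective simplicial map. If K is simple-(n−1)-od-like in the covering sense, then K is homeomorphic to an inverse limit lim←(Y_i, Ψ_i) in which, for each i, Y_i is a simple-ñ_i-od graph for some integer ñ_i with 1 ≤ ñ_i ≤ n−1 and Ψ_i : Y_{i+1} → Y_i is a simplicial map. -/

import Mathlib

/-! ## Simple-m-od covers (nerve combinatorics) -/

/-- A finite indexed open cover of `K` whose nerve is a simple-`m`-od with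
distinguished element `U₀`: the cover consists of `U₀` together with `m`
pairwise disjoint linear chains `U i 1, …, U i (μ i)`, with the prescribed
intersection pattern (writing `U i 0 = U₀` for every `i`). -/
structure SimpleOdCover (K : Type*) [MetricSpace K] (m : ℕ) where
  U₀ : Set K
  μ : Fin m → ℕ
  U : Fin m → ℕ → Set K
  base : ∀ i, U i 0 = U₀
  one_le : ∀ i, 1 ≤ μ i
  isOpen₀ : IsOpen U₀
  nonempty₀ : U₀.Nonempty
  isOpen' : ∀ i j, 1 ≤ j → j ≤ μ i → IsOpen (U i j)
  nonempty' : ∀ i j, 1 ≤ j → j ≤ μ i → (U i j).Nonempty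
  covers : (U₀ ∪ ⋃ i, ⋃ j ∈ Set.Icc 1 (μ i), U i j) = Set.univ
  distinct : ∀ i j i' j', j ≤ μ i → j' ≤ μ i' → U i j = U i' j' →
    (j = 0 ∧ j' = 0) ∨ (i = i' ∧ j = j')
  inter_iff : ∀ i j i' j', j ≤ μ i → j' ≤ μ i' →
    ((U i j ∩ U i' j').Nonempty ↔
      (i = i' ∧ j ≤ j' + 1 ∧ j' ≤ j + 1) ∨ (min j j' = 0 ∧ max j j' ≤ 1))

namespace SimpleOdCover

variable {K : Type*} [MetricSpace K] {m m' : ℕ}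

/-- The elements of the cover. -/
def mem (C : SimpleOdCover K m) (s : Set K) : Prop :=
  s = C.U₀ ∨ ∃ i j, 1 ≤ j ∧ j ≤ C.μ i ∧ s = C.U i j

/-- The mesh of the cover is `< ε`. -/
def MeshLT (C : SimpleOdCover K m) (ε : ℝ) : Prop :=
  Metric.diam C.U₀ < ε ∧ ∀ i j, 1 ≤ j → j ≤ C.μ i → Metric.diam (C.U i j) < ε

/-- `W` refines `V`: every element of `W` is contained in some element of `V`. -/
def Refines (W : SimpleOdCover K m) (V : SimpleOdCover K m') : Prop :=
  ∀ s, W.mem s → ∃ t, V.mem t ∧ s ⊆ t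

/-- `A` is an amalgamation of `W`: every element of `A` is a union of elements of `W`. -/
def IsAmalgamationOf (A : SimpleOdCover K m) (W : SimpleOdCover K m') : Prop :=
  ∀ s, A.mem s → ∃ 𝒮 : Set (Set K), (∀ u ∈ 𝒮, W.mem u) ∧ s = ⋃₀ 𝒮

end SimpleOdCover

/-- `K` is simple-`m`-od-like in the covering sense. -/
def SimpleOdLikeCov (K : Type*) [MetricSpace K] (m : ℕ) : Prop :=
  ∀ ε : ℝ, 0 < ε → ∃ C : SimpleOdCover K m, C.MeshLT ε

/-- `v` is a branch point of `K` of order `m`. -/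
def IsBranchPointOfOrder {K : Type*} [MetricSpace K] (v : K) (m : ℕ) : Prop :=
  ∀ ε : ℝ, 0 < ε → ∃ C : SimpleOdCover K m, C.MeshLT ε ∧ v ∈ C.U₀
/-! ## Graphs (geometric realizations of finite connected 1-complexes) -/

/-- The data of a graph structure on a space `G`: a finite vertex set and
finitely many parametrized edges. -/
structure GraphData (G : Type*) where
  verts : Finset G
  nE : ℕ
  edge : Fin nE → ℝ → G

namespace GraphData

variable {G : Type*}

/-- Two vertices are adjacent if they are joined by an edge. -/
def Adj (Γ : GraphData G) (v w : G) : Prop :=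
  ∃ e, ({Γ.edge e 0, Γ.edge e 1} : Set G) = {v, w}

/-- The axioms making `Γ` an actual graph (a finite connected one-dimensional
simplicial complex realized in `G`): each edge is an arc (parametrized by `[0,1]`)
joining two distinct vertices, open edges avoid the vertices, the edges cover `G`,
two distinct edges meet only in vertices, and an edge is determined by its
endpoints. -/
def IsGraph [TopologicalSpace G] (Γ : GraphData G) : Prop :=
  (∀ e, ContinuousOn (Γ.edge e) (Set.Icc 0 1)) ∧
  (∀ e, Set.InjOn (Γ.edge e) (Set.Icc 0 1)) ∧
  (∀ e, Γ.edge e 0 ∈ Γ.verts) ∧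
  (∀ e, Γ.edge e 1 ∈ Γ.verts) ∧
  (∀ e, Γ.edge e 0 ≠ Γ.edge e 1) ∧
  (∀ e, ∀ t ∈ Set.Ioo (0:ℝ) 1, Γ.edge e t ∉ (Γ.verts : Set G)) ∧
  (⋃ e, Γ.edge e '' Set.Icc 0 1) = Set.univ ∧
  (∀ e e', e ≠ e' →
    (Γ.edge e '' Set.Icc 0 1) ∩ (Γ.edge e' '' Set.Icc 0 1) ⊆ (Γ.verts : Set G)) ∧
  (∀ e e', ({Γ.edge e 0, Γ.edge e 1} : Set G) = {Γ.edge e' 0, Γ.edge e' 1} → e = e')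

end GraphData

/-- A simplicial map between graphs: continuous, vertices to vertices, and each
edge is mapped either onto a vertex or, affinely with respect to the fixed
parametrizations, onto an edge. -/
def IsSimplicialMap {G H : Type*} [TopologicalSpace G] [TopologicalSpace H]
    (Γ : GraphData G) (Δ : GraphData H) (φ : G → H) : Prop :=
  Continuous φ ∧ (∀ v ∈ Γ.verts, φ v ∈ Δ.verts) ∧
  ∀ e, (∃ w ∈ Δ.verts, ∀ t ∈ Set.Icc (0:ℝ) 1, φ (Γ.edge e t) = w) ∨
    ∃ e', (∀ t ∈ Set.Icc (0:ℝ) 1, φ (Γ.edge e t) = Δ.edge e' t) ∨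
          (∀ t ∈ Set.Icc (0:ℝ) 1, φ (Γ.edge e t) = Δ.edge e' (1 - t))

/-- `Γ` is a simple-`m`-od graph with branch point `t₀` and arms given by the
vertex paths `⟨t₀, t i 1, …, t i (k i)⟩` (`i < m`): the arms are nondegenerate,
pairwise meet exactly in `t₀`, exhaust the vertices, and two vertices are
adjacent exactly when they are consecutive on an arm. -/
def IsSimpleOdWith {G : Type*} [TopologicalSpace G] (Γ : GraphData G) (m : ℕ) (t₀ : G)
    (k : Fin m → ℕ) (t : Fin m → ℕ → G) : Prop :=
  Γ.IsGraph ∧ (∀ i, 1 ≤ k i) ∧ (∀ i, t i 0 = t₀) ∧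
  ((Γ.verts : Set G) = {t₀} ∪ {x | ∃ i j, 1 ≤ j ∧ j ≤ k i ∧ x = t i j}) ∧
  (∀ i j i' j', 1 ≤ j → j ≤ k i → 1 ≤ j' → j' ≤ k i' → t i j = t i' j' →
    i = i' ∧ j = j') ∧
  (∀ i j, 1 ≤ j → j ≤ k i → t i j ≠ t₀) ∧
  (∀ v w, Γ.Adj v w ↔ ∃ i j, j + 1 ≤ k i ∧ ({v, w} : Set G) = {t i j, t i (j + 1)})

/-- `Γ` is a simple-`m`-od graph with branch point `t₀`. -/
def IsSimpleOdGraphData {G : Type*} [TopologicalSpace G] (Γ : GraphData G) (m : ℕ)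
    (t₀ : G) : Prop :=
  ∃ k t, IsSimpleOdWith Γ m t₀ k t

/-- Composite bonding maps `Φ_i^{i+k} : X (i+k) → X i` of an inverse sequence. -/
def bondIter {X : ℕ → Type*} (Φ : ∀ i, X (i + 1) → X i) (i : ℕ) :
    ∀ k : ℕ, X (i + k) → X i
  | 0 => id
  | k + 1 => fun x => bondIter Φ i k (Φ (i + k) x)

/-- The inverse limit of an inverse sequence of spaces. -/
def InvLimit {X : ℕ → Type*} (Φ : ∀ i, X (i + 1) → X i) : Type _ :=
  {x : ∀ i, X i // ∀ i, Φ i (x (i + 1)) = x i}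

instance {X : ℕ → Type*} [∀ i, TopologicalSpace (X i)] (Φ : ∀ i, X (i + 1) → X i) :
    TopologicalSpace (InvLimit Φ) :=
  instTopologicalSpaceSubtype

/-! ## The standard simple-od -/

/-- The standard simple-`m`-od in `ℝ^m` with arms along the positive coordinate axes,
the `a`-th arm having length `k a`. -/
def StdOd (m : ℕ) (k : Fin m → ℕ) : Type :=
  {x : Fin m → ℝ // ∃ a, ∃ r ∈ Set.Icc (0 : ℝ) (k a), x = Pi.single a r}

namespace StdOd

variable {m : ℕ} {k : Fin m → ℕ}

noncomputable instance : MetricSpace (StdOd m k) :=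
  inferInstanceAs (MetricSpace {x : Fin m → ℝ // ∃ a, ∃ r ∈ Set.Icc (0 : ℝ) (k a),
    x = Pi.single a r})

/-- The point at distance `r` from the branch point on the `a`-th arm
(with `r` truncated to `[0, k a]`). -/
noncomputable def pt (k : Fin m → ℕ) (a : Fin m) (r : ℝ) : StdOd m k :=
  ⟨Pi.single a (max 0 (min r (k a))), a, _, ⟨le_max_left _ _, by simp⟩, rfl⟩

lemma pt_val {a : Fin m} {r : ℝ} (hr : r ∈ Set.Icc (0 : ℝ) (k a)) :
    (pt k a r).1 = Pi.single a r := by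
  simp [pt, min_eq_left hr.2, max_eq_right hr.1]

lemma exists_pt (x : StdOd m k) : ∃ a, ∃ r ∈ Set.Icc (0 : ℝ) (k a), x = pt k a r := by
  obtain ⟨x, a, r, hr, rfl⟩ := x
  exact ⟨a, r, hr, Subtype.ext (pt_val hr).symm⟩

lemma continuous_pt (a : Fin m) : Continuous (pt k a) := by
  refine Continuous.subtype_mk ?_ _
  exact (continuous_single a).comp (by fun_prop)

lemma pt_eq_iff {a b : Fin m} {r s : ℝ} (hr : r ∈ Set.Icc (0 : ℝ) (k a))
    (hs : s ∈ Set.Icc (0 : ℝ) (k b)) :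
    pt k a r = pt k b s ↔ (r = 0 ∧ s = 0) ∨ (a = b ∧ r = s) := by
  have hval : pt k a r = pt k b s ↔ (pt k a r).1 = (pt k b s).1 := Subtype.ext_iff
  rw [hval, pt_val hr, pt_val hs]
  constructor
  · intro h
    by_cases hab : a = b
    · subst hab
      exact Or.inr ⟨rfl, Pi.single_injective a h⟩
    · left
      have h1 := congrFun h a
      have h2 := congrFun h b
      simp only [Pi.single_eq_same, Pi.single_eq_of_ne hab,
        Pi.single_eq_of_ne (Ne.symm hab)] at h1 h2
      exact ⟨h1, h2.symm⟩
  · rintro (⟨rfl, rfl⟩ | ⟨rfl, rfl⟩) <;> simp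

lemma natCast_mem {a : Fin m} {j : ℕ} (hj : j ≤ k a) : (j : ℝ) ∈ Set.Icc (0 : ℝ) (k a) :=
  ⟨by positivity, by exact_mod_cast hj⟩

lemma pt_nat_eq_iff {a b : Fin m} {i j : ℕ} (hi : i ≤ k a) (hj : j ≤ k b) :
    pt k a i = pt k b j ↔ (i = 0 ∧ j = 0) ∨ (a = b ∧ i = j) := by
  rw [pt_eq_iff (natCast_mem hi) (natCast_mem hj)]
  norm_cast

lemma pt_zero (a b : Fin m) : pt k a 0 = pt k b 0 :=
  (pt_eq_iff (by simp) (by simp)).2 (Or.inl ⟨rfl, rfl⟩)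

lemma isCompact_connected (hm : 0 < m) :
    IsCompact {x : Fin m → ℝ | ∃ a, ∃ r ∈ Set.Icc (0 : ℝ) (k a), x = Pi.single a r} ∧
    IsConnected {x : Fin m → ℝ | ∃ a, ∃ r ∈ Set.Icc (0 : ℝ) (k a), x = Pi.single a r} := by
  have h : {x : Fin m → ℝ | ∃ a, ∃ r ∈ Set.Icc (0 : ℝ) (k a), x = Pi.single a r} =
      ⋃ a, (fun r : ℝ => (Pi.single a r : Fin m → ℝ)) '' Set.Icc (0 : ℝ) (k a) := by
    ext x
    simp only [Set.mem_ofPred_eq, Set.mem_iUnion, Set.mem_image, eq_comm]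
  have hc (a : Fin m) : Continuous fun r : ℝ => (Pi.single a r : Fin m → ℝ) :=
    continuous_single (A := fun _ : Fin m => ℝ) a
  rw [h]
  refine ⟨isCompact_iUnion fun a => isCompact_Icc.image (hc a),
    ⟨0, Set.mem_iUnion.2 ⟨⟨0, hm⟩, 0, by simp⟩⟩, ?_⟩
  refine isPreconnected_iUnion ⟨0, Set.mem_iInter.2 fun a => ⟨0, by simp⟩⟩ fun a => ?_
  exact isPreconnected_Icc.image _ (hc a).continuousOn

lemma compactSpace (hm : 0 < m) : CompactSpace (StdOd m k) :=
  isCompact_iff_compactSpace.1 (isCompact_connected hm).1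

lemma connectedSpace (hm : 0 < m) : ConnectedSpace (StdOd m k) :=
  isConnected_iff_connectedSpace.1 (isCompact_connected hm).2

open Classical in
/-- The graph structure of the standard simple-od, with vertices the integer points. -/
noncomputable def graph (k : Fin m → ℕ) : GraphData (StdOd m k) where
  verts := Finset.univ.image fun p : Σ a, Fin (k a + 1) => pt k p.1 (p.2 : ℕ)
  nE := Fintype.card (Σ a, Fin (k a))
  edge e t := pt k ((Fintype.equivFin _).symm e).1 (((Fintype.equivFin _).symm e).2 + t)

lemma mem_verts {x : StdOd m k} :
    x ∈ (graph k).verts ↔ ∃ a j, j ≤ k a ∧ x = pt k a (j : ℕ) := by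
  simp only [graph, Finset.mem_image, Finset.mem_univ, true_and]
  constructor
  · rintro ⟨⟨a, j⟩, rfl⟩
    exact ⟨a, j, Nat.lt_succ_iff.1 j.2, rfl⟩
  · rintro ⟨a, j, hj, rfl⟩
    exact ⟨⟨a, j, Nat.lt_succ_iff.2 hj⟩, rfl⟩

lemma exists_edge_eq (e : Fin (graph k).nE) :
    ∃ a j, j + 1 ≤ k a ∧ ∀ t, (graph k).edge e t = pt k a ((j : ℕ) + t) :=
  ⟨_, _, ((Fintype.equivFin (Σ a, Fin (k a))).symm e).2.2, fun _ => rfl⟩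

lemma exists_edge {a : Fin m} {j : ℕ} (hj : j + 1 ≤ k a) :
    ∃ e, ∀ t, (graph k).edge e t = pt k a (j + t) :=
  ⟨Fintype.equivFin (Σ a, Fin (k a)) ⟨a, j, hj⟩, fun t => by
    simp only [graph]
    rw [Equiv.symm_apply_apply]⟩

lemma edge_ext {e e' : Fin (graph k).nE} {a : Fin m} {j : ℕ} (hj : j + 1 ≤ k a)
    (h : ∀ t, (graph k).edge e t = pt k a (j + t))
    (h' : ∀ t, (graph k).edge e' t = pt k a (j + t)) : e = e' := by
  have key : ∀ e : Fin (graph k).nE, (∀ t, (graph k).edge e t = pt k a (j + t)) →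
      (Fintype.equivFin (Σ a, Fin (k a))).symm e = ⟨a, j, hj⟩ := by
    intro e he
    have h1 := he 1
    simp only [graph] at h1
    generalize (Fintype.equivFin (Σ a, Fin (k a))).symm e = p at h1
    obtain ⟨b, i, hi⟩ := p
    have := (pt_nat_eq_iff (k := k) (a := b) (b := a) (i := i + 1) (j := j + 1) hi hj).1
      (by push_cast; exact h1)
    obtain ⟨h, -⟩ | ⟨rfl, h⟩ := this
    · omega
    · obtain rfl : i = j := by omega
      rfl
  exact (Fintype.equivFin (Σ a, Fin (k a))).symm.injective ((key e h).trans (key e' h').symm)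

lemma natCast_add_mem {a : Fin m} {j : ℕ} (hj : j + 1 ≤ k a) {t : ℝ} (ht : t ∈ Set.Icc (0 : ℝ) 1) :
    (j : ℝ) + t ∈ Set.Icc (0 : ℝ) (k a) := by
  have : (j : ℝ) + 1 ≤ k a := by exact_mod_cast hj
  exact ⟨add_nonneg (by positivity) ht.1, by linarith [ht.2]⟩

lemma pt_mem_verts {a : Fin m} {j : ℕ} (hj : j ≤ k a) : pt k a (j : ℕ) ∈ (graph k).verts :=
  mem_verts.2 ⟨a, j, hj, rfl⟩

lemma pair_eq_pair {a b : Fin m} {i j : ℕ} (hi : i + 1 ≤ k a) (hj : j + 1 ≤ k b)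
    (h : ({pt k a (i : ℕ), pt k a (i + 1 : ℕ)} : Set (StdOd m k)) =
      {pt k b (j : ℕ), pt k b (j + 1 : ℕ)}) : a = b ∧ i = j := by
  have h1 : pt k a (i : ℕ) ∈ ({pt k b (j : ℕ), pt k b (j + 1 : ℕ)} : Set (StdOd m k)) := by
    rw [← h]; simp
  have h2 : pt k a (i + 1 : ℕ) ∈ ({pt k b (j : ℕ), pt k b (j + 1 : ℕ)} : Set (StdOd m k)) := by
    rw [← h]; simp
  simp only [Set.mem_insert_iff, Set.mem_singleton_iff] at h1 h2
  rw [pt_nat_eq_iff (by omega) (by omega), pt_nat_eq_iff (by omega) (by omega)] at h1 h2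
  omega

lemma isGraph (hk : ∀ a, 1 ≤ k a) : (graph k).IsGraph := by
  refine ⟨?_, ?_, ?_, ?_, ?_, ?_, ?_, ?_, ?_⟩
  · intro e
    obtain ⟨a, j, hj, he⟩ := exists_edge_eq e
    rw [funext he]
    exact ((continuous_pt a).comp (continuous_const.add continuous_id)).continuousOn
  · intro e t ht s hs hts
    obtain ⟨a, j, hj, he⟩ := exists_edge_eq e
    rw [he, he, pt_eq_iff (natCast_add_mem hj ht) (natCast_add_mem hj hs)] at hts
    rcases hts with ⟨h1, h2⟩ | ⟨-, h⟩ <;> linarith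
  · intro e
    obtain ⟨a, j, hj, he⟩ := exists_edge_eq e
    rw [he, add_zero]
    exact pt_mem_verts (by omega)
  · intro e
    obtain ⟨a, j, hj, he⟩ := exists_edge_eq e
    rw [he]
    exact_mod_cast pt_mem_verts hj
  · intro e h
    obtain ⟨a, j, hj, he⟩ := exists_edge_eq e
    rw [he, he, pt_eq_iff (natCast_add_mem hj (by simp)) (natCast_add_mem hj (by simp))] at h
    rcases h with ⟨h1, h2⟩ | ⟨-, h⟩ <;> linarith
  · intro e t ht hv
    obtain ⟨a, j, hj, he⟩ := exists_edge_eq e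
    obtain ⟨b, i, hi, h⟩ := mem_verts.1 hv
    rw [he, pt_eq_iff (natCast_add_mem hj ⟨ht.1.le, ht.2.le⟩) (natCast_mem hi)] at h
    have hj0 : (0 : ℝ) ≤ j := by positivity
    rcases h with ⟨h1, -⟩ | ⟨-, h⟩
    · linarith [ht.1]
    · have h1 : (j : ℝ) < i := by linarith [ht.1]
      have h2 : (i : ℝ) < j + 1 := by linarith [ht.2]
      norm_cast at h1 h2
      omega
  · refine Set.eq_univ_of_forall fun x => ?_
    obtain ⟨a, r, hr, rfl⟩ := exists_pt x
    obtain ⟨j, hj, t, ht, rfl⟩ : ∃ j : ℕ, j + 1 ≤ k a ∧ ∃ t ∈ Set.Icc (0 : ℝ) 1, r = j + t := by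
      rcases hr.2.lt_or_eq with h | h
      · exact ⟨⌊r⌋₊, (Nat.floor_lt hr.1).2 h, r - ⌊r⌋₊,
          ⟨by linarith [Nat.floor_le hr.1], by linarith [Nat.lt_floor_add_one r]⟩, by ring⟩
      · refine ⟨k a - 1, by have := hk a; omega, 1, by simp, ?_⟩
        rw [h, Nat.cast_sub (hk a)]
        simp
    obtain ⟨e, he⟩ := exists_edge hj
    exact Set.mem_iUnion.2 ⟨e, t, ht, he t⟩
  · rintro e e' hee x ⟨⟨t, ht, rfl⟩, s, hs, hst⟩
    obtain ⟨a, j, hj, he⟩ := exists_edge_eq e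
    obtain ⟨b, i, hi, he'⟩ := exists_edge_eq e'
    rw [Finset.mem_coe, mem_verts, he]
    rw [he, he', pt_eq_iff (natCast_add_mem hi hs) (natCast_add_mem hj ht)] at hst
    rcases hst with ⟨h1, h2⟩ | ⟨rfl, h⟩
    · exact ⟨a, 0, by omega, by rw [h2]; simp⟩
    · rcases lt_trichotomy i j with hij | rfl | hij
      · have : (i : ℝ) + 1 ≤ j := by exact_mod_cast hij
        exact ⟨b, j, by omega, by rw [show (j : ℝ) + t = j by linarith [hs.2, ht.1]]⟩
      · exact absurd (edge_ext hj he he') hee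
      · have : (j : ℝ) + 1 ≤ i := by exact_mod_cast hij
        exact ⟨b, i, by omega, by rw [show (j : ℝ) + t = i by linarith [ht.2, hs.1]]⟩
  · intro e e' h
    obtain ⟨a, j, hj, he⟩ := exists_edge_eq e
    obtain ⟨b, i, hi, he'⟩ := exists_edge_eq e'
    rw [he, he, he', he', add_zero, add_zero] at h
    obtain ⟨rfl, rfl⟩ := pair_eq_pair hj hi (by exact_mod_cast h)
    exact edge_ext hj he he'

lemma adj_iff {v w : StdOd m k} : (graph k).Adj v w ↔
    ∃ a j, j + 1 ≤ k a ∧ ({v, w} : Set (StdOd m k)) = {pt k a (j : ℕ), pt k a (j + 1 : ℕ)} := by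
  constructor
  · rintro ⟨e, h⟩
    obtain ⟨a, j, hj, he⟩ := exists_edge_eq e
    refine ⟨a, j, hj, ?_⟩
    rw [← h, he, he]
    simp
  · rintro ⟨a, j, hj, h⟩
    obtain ⟨e, he⟩ := exists_edge hj
    refine ⟨e, ?_⟩
    rw [h, he, he]
    simp

lemma isSimpleOd (hm : 0 < m) (hk : ∀ a, 1 ≤ k a) :
    IsSimpleOdGraphData (graph k) m (pt k ⟨0, hm⟩ 0) := by
  refine ⟨k, fun a j => pt k a j, isGraph hk, hk, fun a => ?_, ?_, ?_, ?_, fun v w => adj_iff⟩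
  · simpa using pt_zero a _
  · ext x
    simp only [Finset.mem_coe, mem_verts, Set.mem_union, Set.mem_singleton_iff,
      Set.mem_ofPred_eq]
    constructor
    · rintro ⟨a, j, hj, rfl⟩
      rcases Nat.eq_zero_or_pos j with rfl | h
      · left
        simpa using pt_zero a _
      · exact Or.inr ⟨a, j, h, hj, rfl⟩
    · rintro (rfl | ⟨a, j, -, hj, rfl⟩)
      · exact ⟨⟨0, hm⟩, 0, by omega, by simp⟩
      · exact ⟨a, j, hj, rfl⟩
  · intro a j b i hj hj' hi hi' h
    have := (pt_nat_eq_iff hj' hi').1 h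
    omega
  · intro a j hj hj' h
    have := (pt_nat_eq_iff (k := k) (j := 0) (b := ⟨0, hm⟩) hj' (by omega)).1 (by simpa using h)
    omega

end StdOd

/-! ## Graphs and simplicial maps -/

namespace GraphData

lemma Adj.symm {G : Type*} {Γ : GraphData G} {v w : G} (h : Γ.Adj v w) : Γ.Adj w v := by
  obtain ⟨e, he⟩ := h
  exact ⟨e, he.trans (Set.pair_comm _ _)⟩

variable {G H : Type*} [TopologicalSpace G] [TopologicalSpace H] {Γ : GraphData G}
  {Δ : GraphData H}

lemma IsGraph.exists_edge_eq (hΓ : Γ.IsGraph) (x : G) :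
    ∃ e, ∃ t ∈ Set.Icc (0 : ℝ) 1, Γ.edge e t = x := by
  have h : x ∈ ⋃ e, Γ.edge e '' Set.Icc 0 1 := by rw [hΓ.2.2.2.2.2.2.1]; trivial
  simpa using h

lemma IsGraph.eq_zero_or_one (hΓ : Γ.IsGraph) {e : Fin Γ.nE} {t : ℝ}
    (ht : t ∈ Set.Icc (0 : ℝ) 1) (hv : Γ.edge e t ∈ Γ.verts) : t = 0 ∨ t = 1 := by
  by_contra! h
  exact hΓ.2.2.2.2.2.1 e t ⟨lt_of_le_of_ne ht.1 h.1.symm, lt_of_le_of_ne ht.2 h.2⟩ hv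

lemma IsGraph.edge_eq_edge (hΓ : Γ.IsGraph) {e e' : Fin Γ.nE} {t t' : ℝ}
    (ht : t ∈ Set.Icc (0 : ℝ) 1) (ht' : t' ∈ Set.Icc (0 : ℝ) 1)
    (h : Γ.edge e t = Γ.edge e' t') :
    (e = e' ∧ t = t') ∨ Γ.edge e t ∈ Γ.verts := by
  by_cases he : e = e'
  · subst he
    exact Or.inl ⟨rfl, hΓ.2.1 e ht ht' h⟩
  · exact Or.inr (hΓ.2.2.2.2.2.2.2.1 e e' he ⟨⟨t, ht, rfl⟩, ⟨t', ht', h.symm⟩⟩)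

lemma IsGraph.exists_glue [T2Space G] (hΓ : Γ.IsGraph) (gv : G → H)
    (ρ : Fin Γ.nE → ℝ → H) (hρ : ∀ e, ContinuousOn (ρ e) (Set.Icc 0 1))
    (h0 : ∀ e, ρ e 0 = gv (Γ.edge e 0)) (h1 : ∀ e, ρ e 1 = gv (Γ.edge e 1)) :
    ∃ φ : G → H, Continuous φ ∧ ∀ e, ∀ t ∈ Set.Icc (0 : ℝ) 1, φ (Γ.edge e t) = ρ e t := by
  choose E T hT hE using hΓ.exists_edge_eq
  have hvert : ∀ e, ∀ t ∈ Set.Icc (0 : ℝ) 1, Γ.edge e t ∈ Γ.verts →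
      ρ e t = gv (Γ.edge e t) := by
    intro e t ht hv
    rcases hΓ.eq_zero_or_one ht hv with rfl | rfl
    exacts [h0 e, h1 e]
  have hφ : ∀ e, ∀ t ∈ Set.Icc (0 : ℝ) 1,
      ρ (E (Γ.edge e t)) (T (Γ.edge e t)) = ρ e t := by
    intro e t ht
    have hx := hE (Γ.edge e t)
    rcases hΓ.edge_eq_edge (hT _) ht hx with ⟨he, ht'⟩ | hv
    · rw [he, ht']
    · rw [hvert _ _ (hT _) hv, hx, hvert _ _ ht (hx ▸ hv)]
  refine ⟨fun x => ρ (E x) (T x), continuous_iff_isClosed.2 fun C hC => ?_, hφ⟩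
  have : (fun x => ρ (E x) (T x)) ⁻¹' C =
      ⋃ e, Γ.edge e '' (Set.Icc 0 1 ∩ ρ e ⁻¹' C) := by
    ext x
    simp only [Set.mem_preimage, Set.mem_iUnion, Set.mem_image]
    constructor
    · exact fun hx => ⟨E x, T x, ⟨hT x, hx⟩, hE x⟩
    · rintro ⟨e, t, ⟨ht, htC⟩, rfl⟩
      rw [hφ e t ht]
      exact htC
  rw [this]
  refine isClosed_iUnion_of_finite fun e => IsCompact.isClosed ?_
  exact (isCompact_Icc.of_isClosed_subset ((hρ e).preimage_isClosed_of_isClosed isClosed_Icc hC)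
    Set.inter_subset_left).image_of_continuousOn ((hΓ.1 e).mono Set.inter_subset_left)

lemma IsGraph.isOpen_of_edges [T2Space G] (hΓ : Γ.IsGraph) {O : Fin Γ.nE → Set ℝ}
    (hO : ∀ e, IsOpen (O e)) :
    IsOpen {x | ∀ e, ∀ t ∈ Set.Icc (0 : ℝ) 1, Γ.edge e t = x → t ∈ O e} := by
  have : {x | ∀ e, ∀ t ∈ Set.Icc (0 : ℝ) 1, Γ.edge e t = x → t ∈ O e}ᶜ =
      ⋃ e, Γ.edge e '' (Set.Icc 0 1 ∩ (O e)ᶜ) := by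
    ext x
    simp only [Set.mem_compl_iff, Set.mem_ofPred_eq, Set.mem_iUnion, Set.mem_image,
      Set.mem_inter_iff]
    push Not
    constructor
    · rintro ⟨e, t, ht, h, h'⟩
      exact ⟨e, t, ⟨ht, h'⟩, h⟩
    · rintro ⟨e, t, ⟨ht, h'⟩, h⟩
      exact ⟨e, t, ht, h, h'⟩
  rw [← isClosed_compl_iff, this]
  refine isClosed_iUnion_of_finite fun e => IsCompact.isClosed ?_
  exact (isCompact_Icc.inter_right (hO e).isClosed_compl).image_of_continuousOn
    ((hΓ.1 e).mono Set.inter_subset_left)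

lemma IsGraph.exists_isSimplicialMap [T2Space G] (hΓ : Γ.IsGraph) (hΔ : Δ.IsGraph) (gv : G → H)
    (hv : ∀ v ∈ Γ.verts, gv v ∈ Δ.verts)
    (he : ∀ e, gv (Γ.edge e 0) = gv (Γ.edge e 1) ∨
      Δ.Adj (gv (Γ.edge e 0)) (gv (Γ.edge e 1))) :
    ∃ φ : G → H, IsSimplicialMap Γ Δ φ ∧ ∀ v ∈ Γ.verts, φ v = gv v := by
  have key : ∀ e, ∃ ρ : ℝ → H, ContinuousOn ρ (Set.Icc 0 1) ∧ ρ 0 = gv (Γ.edge e 0) ∧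
      ρ 1 = gv (Γ.edge e 1) ∧ ((∃ w ∈ Δ.verts, ∀ t ∈ Set.Icc (0:ℝ) 1, ρ t = w) ∨
        ∃ e', (∀ t ∈ Set.Icc (0:ℝ) 1, ρ t = Δ.edge e' t) ∨
          (∀ t ∈ Set.Icc (0:ℝ) 1, ρ t = Δ.edge e' (1 - t))) := by
    intro e
    rcases he e with h | ⟨e', h⟩
    · exact ⟨fun _ => gv (Γ.edge e 0), continuousOn_const, rfl, h,
        Or.inl ⟨_, hv _ (hΓ.2.2.1 e), fun _ _ => rfl⟩⟩
    · rcases Set.pair_eq_pair_iff.1 h with ⟨h0, h1⟩ | ⟨h0, h1⟩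
      · exact ⟨Δ.edge e', hΔ.1 e', h0, h1, Or.inr ⟨e', Or.inl fun _ _ => rfl⟩⟩
      · refine ⟨fun t => Δ.edge e' (1 - t), (hΔ.1 e').comp (by fun_prop) fun t ht => ?_,
          by simpa using h1, by simpa using h0, Or.inr ⟨e', Or.inr fun _ _ => rfl⟩⟩
        exact ⟨by linarith [ht.2], by linarith [ht.1]⟩
  choose ρ hc h0 h1 hs using key
  obtain ⟨φ, hφ, hφe⟩ := hΓ.exists_glue gv ρ hc h0 h1
  have hφv : ∀ v ∈ Γ.verts, φ v = gv v := by
    intro v hv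
    obtain ⟨e, t, ht, rfl⟩ := hΓ.exists_edge_eq v
    rw [hφe e t ht]
    rcases hΓ.eq_zero_or_one ht hv with rfl | rfl
    exacts [h0 e, h1 e]
  refine ⟨φ, ⟨hφ, fun v h => by rw [hφv v h]; exact hv v h, fun e => ?_⟩, hφv⟩
  rcases hs e with ⟨w, hw, h⟩ | ⟨e', h | h⟩
  · exact Or.inl ⟨w, hw, fun t ht => (hφe e t ht).trans (h t ht)⟩
  · exact Or.inr ⟨e', Or.inl fun t ht => (hφe e t ht).trans (h t ht)⟩
  · exact Or.inr ⟨e', Or.inr fun t ht => (hφe e t ht).trans (h t ht)⟩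

end GraphData

namespace IsSimplicialMap

variable {G H J : Type*} [TopologicalSpace G] [TopologicalSpace H] [TopologicalSpace J]
  {Γ : GraphData G} {Δ : GraphData H} {Θ : GraphData J}

lemma id (Γ : GraphData G) : IsSimplicialMap Γ Γ _root_.id :=
  ⟨continuous_id, fun _ h => h, fun e => Or.inr ⟨e, Or.inl fun _ _ => rfl⟩⟩

lemma comp {ψ : H → J} {φ : G → H} (hψ : IsSimplicialMap Δ Θ ψ) (hφ : IsSimplicialMap Γ Δ φ) :
    IsSimplicialMap Γ Θ (ψ ∘ φ) := by
  have hs {t : ℝ} (ht : t ∈ Set.Icc (0 : ℝ) 1) : 1 - t ∈ Set.Icc (0 : ℝ) 1 :=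
    ⟨by linarith [ht.2], by linarith [ht.1]⟩
  refine ⟨hψ.1.comp hφ.1, fun v hv => hψ.2.1 _ (hφ.2.1 v hv), fun e => ?_⟩
  rcases hφ.2.2 e with ⟨w, hw, h⟩ | ⟨e', h | h⟩
  · exact Or.inl ⟨_, hψ.2.1 w hw, fun t ht => by rw [Function.comp_apply, h t ht]⟩
  · rcases hψ.2.2 e' with ⟨w, hw, h'⟩ | ⟨e'', h' | h'⟩
    · exact Or.inl ⟨w, hw, fun t ht => by rw [Function.comp_apply, h t ht, h' t ht]⟩
    · exact Or.inr ⟨e'', Or.inl fun t ht => by rw [Function.comp_apply, h t ht, h' t ht]⟩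
    · exact Or.inr ⟨e'', Or.inr fun t ht => by rw [Function.comp_apply, h t ht, h' t ht]⟩
  · rcases hψ.2.2 e' with ⟨w, hw, h'⟩ | ⟨e'', h' | h'⟩
    · exact Or.inl ⟨w, hw, fun t ht => by rw [Function.comp_apply, h t ht, h' _ (hs ht)]⟩
    · exact Or.inr ⟨e'', Or.inr fun t ht => by rw [Function.comp_apply, h t ht, h' _ (hs ht)]⟩
    · exact Or.inr ⟨e'', Or.inl fun t ht => by
        rw [Function.comp_apply, h t ht, h' _ (hs ht), sub_sub_cancel]⟩

lemma eq_of_eqOn_verts (hΓ : Γ.IsGraph) (hΔ : Δ.IsGraph) {φ ψ : G → H}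
    (hφ : IsSimplicialMap Γ Δ φ) (hψ : IsSimplicialMap Γ Δ ψ)
    (h : ∀ v ∈ Γ.verts, φ v = ψ v) (x : G) : φ x = ψ x := by
  obtain ⟨e, t, ht, rfl⟩ := hΓ.exists_edge_eq x
  have i0 : (0 : ℝ) ∈ Set.Icc (0 : ℝ) 1 := by simp
  have i1 : (1 : ℝ) ∈ Set.Icc (0 : ℝ) 1 := by simp
  have h0 := h _ (hΓ.2.2.1 e)
  have h1 := h _ (hΓ.2.2.2.1 e)
  have hne := hΔ.2.2.2.2.1
  have huniq := hΔ.2.2.2.2.2.2.2.2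
  rcases hφ.2.2 e with ⟨w, hw, hf⟩ | ⟨a, hf⟩ <;> rcases hψ.2.2 e with ⟨w', hw', hg⟩ | ⟨b, hg⟩
  · rw [hf 0 i0, hg 0 i0] at h0
    rw [hf t ht, hg t ht, h0]
  · rcases hg with hg | hg <;> rw [hf 0 i0, hg 0 i0] at h0 <;> rw [hf 1 i1, hg 1 i1] at h1 <;>
      try simp only [sub_zero, sub_self] at h0 h1
    · exact absurd (h0.symm.trans h1) (hne b)
    · exact absurd (h1.symm.trans h0) (hne b)
  · rcases hf with hf | hf <;> rw [hf 0 i0, hg 0 i0] at h0 <;> rw [hf 1 i1, hg 1 i1] at h1 <;>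
      try simp only [sub_zero, sub_self] at h0 h1
    · exact absurd (h0.trans h1.symm) (hne a)
    · exact absurd (h1.trans h0.symm) (hne a)
  · rcases hf with hf | hf <;> rcases hg with hg | hg <;> rw [hf 0 i0, hg 0 i0] at h0 <;>
      rw [hf 1 i1, hg 1 i1] at h1 <;>
      (try simp only [sub_zero, sub_self] at h0 h1) <;>
      obtain rfl := huniq a b (by rw [h0, h1]; try exact Set.pair_comm _ _)
    · rw [hf t ht, hg t ht]
    · exact absurd h0 (hne a)
    · exact absurd h1 (hne a)
    · rw [hf t ht, hg t ht]

end IsSimplicialMap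

/-! ## Stars of the threefold subdivision of a graph -/

namespace GraphData

section Stars

variable {H : Type*}

/-- Labels of the vertices of the subdivision of a graph in which every edge is cut into three
pieces: vertices of the graph, and two interior points on each edge. -/
abbrev Label (Δ : GraphData H) := H ⊕ (Fin Δ.nE × Bool)

/-- The parameters on the edge `e` at which the open star with the given label is crossed. -/
def labelSet (Δ : GraphData H) : Δ.Label → Fin Δ.nE → Set ℝ
  | Sum.inl w, e => {t | (Δ.edge e 0 = w ∧ t < 1 / 3) ∨ (Δ.edge e 1 = w ∧ 2 / 3 < t)}
  | Sum.inr (e', false), e => {t | e = e' ∧ 0 < t ∧ t < 2 / 3}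
  | Sum.inr (e', true), e => {t | e = e' ∧ 1 / 3 < t ∧ t < 1}

/-- The open star, in the threefold subdivision, of the vertex with the given label. -/
def star (Δ : GraphData H) (l : Δ.Label) : Set H :=
  {x | ∀ e, ∀ t ∈ Set.Icc (0 : ℝ) 1, Δ.edge e t = x → t ∈ Δ.labelSet l e}

/-- The vertex of the graph closest to the subdivision vertex with the given label. -/
def nearest (Δ : GraphData H) : Δ.Label → H
  | Sum.inl w => w
  | Sum.inr (e, false) => Δ.edge e 0
  | Sum.inr (e, true) => Δ.edge e 1

variable {Δ : GraphData H}

lemma isOpen_labelSet (l : Δ.Label) (e : Fin Δ.nE) : IsOpen (Δ.labelSet l e) := by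
  rcases l with w | ⟨e', _ | _⟩
  · exact IsOpen.union (isOpen_const.and (isOpen_lt continuous_id continuous_const))
      (isOpen_const.and (isOpen_lt continuous_const continuous_id))
  · exact isOpen_const.and ((isOpen_lt continuous_const continuous_id).and
      (isOpen_lt continuous_id continuous_const))
  · exact isOpen_const.and ((isOpen_lt continuous_const continuous_id).and
      (isOpen_lt continuous_id continuous_const))

lemma eq_of_mem_star_of_le {l : Δ.Label} {e : Fin Δ.nE} {t : ℝ} (ht : t ∈ Set.Icc (0 : ℝ) 1)
    (h : Δ.edge e t ∈ Δ.star l) (ht' : t ≤ 1 / 3) :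
    l = Sum.inl (Δ.edge e 0) ∨ l = Sum.inr (e, false) := by
  have := h e t ht rfl
  rcases l with w | ⟨e', _ | _⟩
  · rcases this with h | h
    · rw [h.1]; exact Or.inl rfl
    · linarith [h.2]
  · rw [this.1]; exact Or.inr rfl
  · linarith [this.2.1]

lemma eq_of_mem_star_of_ge {l : Δ.Label} {e : Fin Δ.nE} {t : ℝ} (ht : t ∈ Set.Icc (0 : ℝ) 1)
    (h : Δ.edge e t ∈ Δ.star l) (ht' : 2 / 3 ≤ t) :
    l = Sum.inl (Δ.edge e 1) ∨ l = Sum.inr (e, true) := by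
  have := h e t ht rfl
  rcases l with w | ⟨e', _ | _⟩
  · rcases this with h | h
    · linarith [h.2]
    · rw [h.1]; exact Or.inl rfl
  · linarith [this.2.2]
  · rw [this.1]; exact Or.inr rfl

lemma eq_of_mem_star_middle {l : Δ.Label} {e : Fin Δ.nE} {t : ℝ}
    (h : Δ.edge e t ∈ Δ.star l) (ht' : t ∈ Set.Icc (1 / 3 : ℝ) (2 / 3)) :
    ∃ b, l = Sum.inr (e, b) := by
  have := h e t ⟨by linarith [ht'.1], by linarith [ht'.2]⟩ rfl
  rcases l with w | ⟨e', b⟩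
  · rcases this with h | h
    · linarith [h.2, ht'.1]
    · linarith [h.2, ht'.2]
  · cases b <;> (rw [this.1]; exact ⟨_, rfl⟩)

variable [TopologicalSpace H]

lemma IsGraph.isOpen_star [T2Space H] (hΔ : Δ.IsGraph) (l : Δ.Label) : IsOpen (Δ.star l) :=
  hΔ.isOpen_of_edges (isOpen_labelSet l)

lemma IsGraph.exists_mem_star (hΔ : Δ.IsGraph) (x : H) : ∃ l, x ∈ Δ.star l := by
  by_cases hx : x ∈ Δ.verts
  · refine ⟨Sum.inl x, ?_⟩
    rintro e t ht rfl
    rcases hΔ.eq_zero_or_one ht hx with rfl | rfl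
    · exact Or.inl ⟨rfl, by norm_num⟩
    · exact Or.inr ⟨rfl, by norm_num⟩
  · obtain ⟨e, t, ht, rfl⟩ := hΔ.exists_edge_eq x
    have h0 : 0 < t := lt_of_le_of_ne ht.1 (by rintro rfl; exact hx (hΔ.2.2.1 e))
    have h1 : t < 1 := lt_of_le_of_ne ht.2 (by rintro rfl; exact hx (hΔ.2.2.2.1 e))
    have key : ∀ e' t', t' ∈ Set.Icc (0 : ℝ) 1 → Δ.edge e' t' = Δ.edge e t →
        e' = e ∧ t' = t := fun e' t' ht' h =>
      (hΔ.edge_eq_edge ht' ht h).resolve_right (by rwa [h])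
    by_cases h2 : t < 2 / 3
    · refine ⟨Sum.inr (e, false), fun e' t' ht' h => ?_⟩
      obtain ⟨rfl, rfl⟩ := key e' t' ht' h
      exact ⟨rfl, h0, h2⟩
    · refine ⟨Sum.inr (e, true), fun e' t' ht' h => ?_⟩
      obtain ⟨rfl, rfl⟩ := key e' t' ht' h
      exact ⟨rfl, by linarith, h1⟩

lemma IsGraph.mem_verts_of_mem_star (hΔ : Δ.IsGraph) {x w : H}
    (hx : x ∈ Δ.star (Sum.inl w)) : w ∈ Δ.verts := by
  obtain ⟨e, t, ht, rfl⟩ := hΔ.exists_edge_eq x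
  rcases hx e t ht rfl with h | h
  · exact h.1 ▸ hΔ.2.2.1 e
  · exact h.1 ▸ hΔ.2.2.2.1 e

lemma IsGraph.eq_inl_of_mem_star (hΔ : Δ.IsGraph) {w : H} {l : Δ.Label} (hw : w ∈ Δ.verts)
    (hx : w ∈ Δ.star l) : l = Sum.inl w := by
  obtain ⟨e, t, ht, rfl⟩ := hΔ.exists_edge_eq w
  have h := hx e t ht rfl
  rcases hΔ.eq_zero_or_one ht hw with rfl | rfl
  · refine (eq_of_mem_star_of_le ht hx (by norm_num)).resolve_right ?_
    rintro rfl
    exact lt_irrefl _ h.2.1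
  · refine (eq_of_mem_star_of_ge ht hx (by norm_num)).resolve_right ?_
    rintro rfl
    exact lt_irrefl _ h.2.2

lemma IsGraph.inl_eq_inl (hΔ : Δ.IsGraph) {x w w' : H} (hx : x ∈ Δ.star (Sum.inl w))
    (hx' : x ∈ Δ.star (Sum.inl w')) : w = w' := by
  obtain ⟨e, t, ht, rfl⟩ := hΔ.exists_edge_eq x
  rcases hx e t ht rfl with ⟨h, h2⟩ | ⟨h, h2⟩ <;>
    rcases hx' e t ht rfl with ⟨h', h2'⟩ | ⟨h', h2'⟩
  · exact h.symm.trans h'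
  · linarith
  · linarith
  · exact h.symm.trans h'

lemma IsGraph.inl_inr (hΔ : Δ.IsGraph) {x w : H} {e : Fin Δ.nE} {b : Bool}
    (hx : x ∈ Δ.star (Sum.inl w)) (hx' : x ∈ Δ.star (Sum.inr (e, b))) :
    w = Δ.edge e 0 ∨ w = Δ.edge e 1 := by
  obtain ⟨e', t, ht, rfl⟩ := hΔ.exists_edge_eq x
  have h := hx' e' t ht rfl
  obtain rfl : e' = e := by cases b <;> exact h.1
  exact (hx e' t ht rfl).imp (fun h => h.1.symm) fun h => h.1.symm

lemma IsGraph.inr_inr (hΔ : Δ.IsGraph) {x : H} {e e' : Fin Δ.nE} {b b' : Bool}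
    (hx : x ∈ Δ.star (Sum.inr (e, b))) (hx' : x ∈ Δ.star (Sum.inr (e', b'))) : e = e' := by
  obtain ⟨i, t, ht, rfl⟩ := hΔ.exists_edge_eq x
  have h := hx i t ht rfl
  have h' := hx' i t ht rfl
  cases b <;> cases b' <;> exact h.1.symm.trans h'.1

end Stars

/-! ## Compressing a sequence of labels to a sequence of vertices -/

section Compress

variable {H : Type*} {Δ : GraphData H} {lab : ℕ → Δ.Label}

/-- The last vertex label seen up to time `s` along a sequence of labels; initially, the vertex
closest to the first label. -/
def lastVertex (lab : ℕ → Δ.Label) : ℕ → H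
  | 0 => Δ.nearest (lab 0)
  | s + 1 => (lab (s + 1)).elim (fun w => w) fun _ => lastVertex lab s

open Classical in
/-- The number of changes of `lastVertex` up to time `s`. -/
noncomputable def numChanges (lab : ℕ → Δ.Label) : ℕ → ℕ
  | 0 => 0
  | s + 1 => if lastVertex lab (s + 1) = lastVertex lab s then numChanges lab s
      else numChanges lab s + 1

lemma lastVertex_inl {s : ℕ} {w : H} (h : lab s = Sum.inl w) : lastVertex lab s = w := by
  cases s <;> simp [lastVertex, h, nearest]

lemma lastVertex_inr {s : ℕ} {p} (h : lab (s + 1) = Sum.inr p) :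
    lastVertex lab (s + 1) = lastVertex lab s := by
  simp [lastVertex, h]

lemma numChanges_of_eq {s : ℕ} (h : lastVertex lab (s + 1) = lastVertex lab s) :
    numChanges lab (s + 1) = numChanges lab s := by
  simp [numChanges, h]

lemma numChanges_of_ne {s : ℕ} (h : lastVertex lab (s + 1) ≠ lastVertex lab s) :
    numChanges lab (s + 1) = numChanges lab s + 1 := by
  simp [numChanges, h]

lemma numChanges_mono (lab : ℕ → Δ.Label) : Monotone (numChanges lab) := by
  refine monotone_nat_of_le_succ fun s => ?_
  simp only [numChanges]
  split_ifs <;> omega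

open Classical in
/-- The index of the value `A` among the successive values of `lastVertex`, as seen from time `s`:
the current one or the next one. -/
noncomputable def currentOrNext (lab : ℕ → Δ.Label) (A : H) (s : ℕ) : ℕ :=
  if lastVertex lab s = A then numChanges lab s else numChanges lab s + 1

lemma currentOrNext_succ {A : H} {s : ℕ}
    (h' : lab (s + 1) = Sum.inl A ∨ ∃ p, lab (s + 1) = Sum.inr p) :
    currentOrNext lab A s = currentOrNext lab A (s + 1) := by
  rcases h' with h' | ⟨p, h'⟩
  · have h1 := lastVertex_inl h'
    by_cases h2 : lastVertex lab s = A
    · simp [currentOrNext, h1, h2, numChanges_of_eq (h1.trans h2.symm)]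
    · simp [currentOrNext, h1, h2, numChanges_of_ne (h1.trans_ne (Ne.symm h2))]
  · have h1 := lastVertex_inr h'
    rw [currentOrNext, currentOrNext, numChanges_of_eq h1, h1]

variable [TopologicalSpace H]

lemma lastVertex_incident (hΔ : Δ.IsGraph) {M : ℕ}
    (hlab : ∀ s < M, (Δ.star (lab s) ∩ Δ.star (lab (s + 1))).Nonempty) {s : ℕ} (hs : s ≤ M)
    {e : Fin Δ.nE} {b : Bool} (h : lab s = Sum.inr (e, b)) :
    lastVertex lab s = Δ.edge e 0 ∨ lastVertex lab s = Δ.edge e 1 := by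
  induction s generalizing b with
  | zero => cases b <;> simp [lastVertex, h, nearest]
  | succ s ih =>
    rw [lastVertex_inr h]
    obtain ⟨x, hx, hx'⟩ := hlab s hs
    rw [h] at hx'
    rcases hl : lab s with w | ⟨e', b'⟩
    · rw [hl] at hx
      rw [lastVertex_inl hl]
      exact hΔ.inl_inr hx hx'
    · rw [hl] at hx
      obtain rfl := hΔ.inr_inr hx hx'
      exact ih (by omega) hl

lemma lastVertex_succ (hΔ : Δ.IsGraph) {M : ℕ}
    (hlab : ∀ s < M, (Δ.star (lab s) ∩ Δ.star (lab (s + 1))).Nonempty) {s : ℕ} (hs : s < M) :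
    lastVertex lab s = lastVertex lab (s + 1) ∨
      Δ.Adj (lastVertex lab s) (lastVertex lab (s + 1)) := by
  rcases hl' : lab (s + 1) with w' | p
  · rw [lastVertex_inl hl']
    obtain ⟨x, hx, hx'⟩ := hlab s hs
    rw [hl'] at hx'
    rcases hl : lab s with w | ⟨e, b⟩
    · rw [hl] at hx
      rw [lastVertex_inl hl]
      exact Or.inl (hΔ.inl_eq_inl hx hx')
    · rw [hl] at hx
      rcases lastVertex_incident hΔ hlab hs.le hl with h | h <;>
        rcases hΔ.inl_inr hx' hx with h' | h' <;> rw [h, h']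
      · exact Or.inl rfl
      · exact Or.inr ⟨e, rfl⟩
      · exact Or.inr ⟨e, Set.pair_comm _ _⟩
      · exact Or.inl rfl
  · exact Or.inl (lastVertex_inr hl').symm

lemma lastVertex_mem_verts (hΔ : Δ.IsGraph) {M : ℕ}
    (hlab : ∀ s ≤ M, (Δ.star (lab s)).Nonempty) {s : ℕ} (hs : s ≤ M) :
    lastVertex lab s ∈ Δ.verts := by
  induction s with
  | zero =>
    obtain ⟨x, hx⟩ := hlab 0 hs
    rcases hl : lab 0 with w | ⟨e, _ | _⟩
    · rw [hl] at hx
      rw [lastVertex_inl hl]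
      exact hΔ.mem_verts_of_mem_star hx
    · simpa [lastVertex, hl, nearest] using hΔ.2.2.1 e
    · simpa [lastVertex, hl, nearest] using hΔ.2.2.2.1 e
  | succ s ih =>
    obtain ⟨x, hx⟩ := hlab (s + 1) hs
    rcases hl : lab (s + 1) with w | p
    · rw [hl] at hx
      rw [lastVertex_inl hl]
      exact hΔ.mem_verts_of_mem_star hx
    · rw [lastVertex_inr hl]
      exact ih (by omega)

lemma exists_compression (hΔ : Δ.IsGraph) {M : ℕ}
    (hne : ∀ s ≤ M, (Δ.star (lab s)).Nonempty)
    (hlab : ∀ s < M, (Δ.star (lab s) ∩ Δ.star (lab (s + 1))).Nonempty) :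
    ∃ F : ℕ → H, (∀ s ≤ M, F (numChanges lab s) = lastVertex lab s) ∧
      (∀ r, F r ∈ Δ.verts) ∧ ∀ r, F r = F (r + 1) ∨ Δ.Adj (F r) (F (r + 1)) := by
  suffices ∀ S ≤ M, ∃ F : ℕ → H, (∀ s ≤ S, F (numChanges lab s) = lastVertex lab s) ∧
      (∀ r, F r ∈ Δ.verts) ∧ ∀ r, F r = F (r + 1) ∨ Δ.Adj (F r) (F (r + 1)) from this M le_rfl
  intro S hS
  induction S with
  | zero =>
    refine ⟨fun _ => lastVertex lab 0, fun s hs => ?_,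
      fun _ => lastVertex_mem_verts hΔ hne hS, fun _ => Or.inl rfl⟩
    rw [Nat.le_zero.1 hs]
  | succ S ih =>
    obtain ⟨F, hF, hFv, hFa⟩ := ih (by omega)
    by_cases h : lastVertex lab (S + 1) = lastVertex lab S
    · refine ⟨F, fun s hs => ?_, hFv, hFa⟩
      rcases Nat.le_succ_iff.1 hs with hs | rfl
      · exact hF s hs
      · rw [numChanges_of_eq h, h]
        exact hF S le_rfl
    · refine ⟨fun r => if r ≤ numChanges lab S then F r else lastVertex lab (S + 1),
        fun s hs => ?_, fun r => ?_, fun r => ?_⟩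
      · dsimp only
        rcases Nat.le_or_eq_of_le_succ hs with hs | rfl
        · rw [if_pos (numChanges_mono lab hs)]
          exact hF s hs
        · exact if_neg (by rw [numChanges_of_ne h]; omega)
      · dsimp only
        split_ifs
        exacts [hFv r, lastVertex_mem_verts hΔ hne hS]
      · dsimp only
        rcases lt_trichotomy r (numChanges lab S) with hr | rfl | hr
        · rw [if_pos hr.le, if_pos (by omega)]
          exact hFa r
        · rw [if_pos le_rfl, if_neg (by omega), hF S le_rfl]
          exact lastVertex_succ hΔ hlab hS
        · rw [if_neg (by omega), if_neg (by omega)]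
          exact Or.inl rfl

end Compress

end GraphData

/-! ## Factoring a simplicial map through a simple-od along a cover -/

namespace SimpleOdCover

variable {K : Type*} [MetricSpace K] {m : ℕ} (C : SimpleOdCover K m)

lemma isOpen {a : Fin m} {s : ℕ} (hs : s ≤ C.μ a) : IsOpen (C.U a s) := by
  rcases Nat.eq_zero_or_pos s with rfl | h
  · rw [C.base]; exact C.isOpen₀
  · exact C.isOpen' a s h hs

lemma nonempty {a : Fin m} {s : ℕ} (hs : s ≤ C.μ a) : (C.U a s).Nonempty := by
  rcases Nat.eq_zero_or_pos s with rfl | h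
  · rw [C.base]; exact C.nonempty₀
  · exact C.nonempty' a s h hs

lemma exists_mem (hm : 0 < m) (κ : K) : ∃ a s, s ≤ C.μ a ∧ κ ∈ C.U a s := by
  have h : κ ∈ C.U₀ ∪ ⋃ i, ⋃ j ∈ Set.Icc 1 (C.μ i), C.U i j := by rw [C.covers]; trivial
  rcases h with h | h
  · exact ⟨⟨0, hm⟩, 0, Nat.zero_le _, by rwa [C.base]⟩
  · simp only [Set.mem_iUnion] at h
    obtain ⟨a, s, hs, h⟩ := h
    exact ⟨a, s, hs.2, h⟩

variable {C} {T : Type*} {f : Fin m → ℕ → T} {Q : Set K → Prop}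

/-- A function on the elements of a simple-od cover, defined arm by arm, takes the same value on
intersecting elements satisfying `Q` as soon as it does so on consecutive ones. -/
lemma eq_of_inter_nonempty (h0 : Q C.U₀ → ∀ a b, f a 0 = f b 0)
    (hstep : ∀ a s, s + 1 ≤ C.μ a → Q (C.U a s) → Q (C.U a (s + 1)) → f a s = f a (s + 1))
    {a b : Fin m} {s t : ℕ} (hs : s ≤ C.μ a) (ht : t ≤ C.μ b) (hQs : Q (C.U a s))
    (hQt : Q (C.U b t)) (hne : (C.U a s ∩ C.U b t).Nonempty) : f a s = f b t := by
  rcases (C.inter_iff a s b t hs ht).1 hne with ⟨rfl, h1, h2⟩ | ⟨h1, h2⟩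
  · rcases lt_trichotomy s t with h | rfl | h
    · obtain rfl : t = s + 1 := by omega
      exact hstep a s ht hQs hQt
    · rfl
    · obtain rfl : s = t + 1 := by omega
      exact (hstep a t hs hQt hQs).symm
  · rcases Nat.eq_zero_or_pos s with rfl | h
    · have h0' := h0 (C.base a ▸ hQs) a b
      rcases Nat.eq_zero_or_pos t with rfl | h
      · exact h0'
      · obtain rfl : t = 0 + 1 := by omega
        exact h0'.trans (hstep b 0 ht (C.base b ▸ C.base a ▸ hQs) hQt)
    · obtain rfl : s = 0 + 1 := by omega
      obtain rfl : t = 0 := by omega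
      exact (hstep a 0 hs (C.base a ▸ C.base b ▸ hQt) hQs).symm.trans (h0 (C.base b ▸ hQt) a b)

/-- A function on the elements of a simple-od cover which agrees on consecutive elements
satisfying `Q` is constant along paths meeting only such elements. -/
lemma eq_along_path {G : Type*} [TopologicalSpace G] {P : K → G} (hP : Function.Surjective P)
    {c : G → Fin m × ℕ}
    (hc : ∀ x, (c x).2 ≤ C.μ (c x).1 ∧ ∃ V, IsOpen V ∧ x ∈ V ∧ P ⁻¹' V ⊆ C.U (c x).1 (c x).2)
    (h0 : Q C.U₀ → ∀ a b, f a 0 = f b 0)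
    (hstep : ∀ a s, s + 1 ≤ C.μ a → Q (C.U a s) → Q (C.U a (s + 1)) → f a s = f a (s + 1))
    {γ : ℝ → G} {p q : ℝ} (hpq : p ≤ q) (hγ : ContinuousOn γ (Set.Icc p q))
    (hQ : ∀ t ∈ Set.Icc p q, Q (C.U (c (γ t)).1 (c (γ t)).2)) :
    f (c (γ p)).1 (c (γ p)).2 = f (c (γ q)).1 (c (γ q)).2 := by
  refine isPreconnected_Icc.induction₂ (s := Set.Icc p q)
    (fun t u => f (c (γ t)).1 (c (γ t)).2 = f (c (γ u)).1 (c (γ u)).2)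
    (fun t ht => ?_) (fun _ _ _ _ _ _ h h' => h.trans h') (fun _ _ _ _ h => h.symm)
    (Set.left_mem_Icc.2 hpq) (Set.right_mem_Icc.2 hpq)
  obtain ⟨V, hV, htV, hPV⟩ := (hc (γ t)).2
  filter_upwards [hγ t ht (hV.mem_nhds htV), self_mem_nhdsWithin] with u hu hu'
  obtain ⟨κ, hκ⟩ := hP (γ u)
  obtain ⟨W, -, huW, hPW⟩ := (hc (γ u)).2
  refine eq_of_inter_nonempty h0 hstep (hc _).1 (hc _).1 (hQ t ht) (hQ u hu')
    ⟨κ, hPV ?_, hPW ?_⟩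
  · rw [Set.mem_preimage, hκ]; exact hu
  · rw [Set.mem_preimage, hκ]; exact huW

end SimpleOdCover

section Factor

open GraphData

/-- The labels of the elements along an arm of a simple-od cover. -/
def SimpleOdCover.armLabel {K Λ : Type*} [MetricSpace K] {m : ℕ} (C : SimpleOdCover K m)
    (L : Set K → Λ) (a : Fin m) (s : ℕ) : Λ :=
  L (C.U a s)

lemma SimpleOdCover.armLabel_zero {K Λ : Type*} [MetricSpace K] {m : ℕ}
    (C : SimpleOdCover K m) (L : Set K → Λ) (a : Fin m) : C.armLabel L a 0 = L C.U₀ := by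
  rw [armLabel, C.base]

variable {K G H : Type*} [MetricSpace K] [MetricSpace H] {Δ : GraphData H} {m : ℕ}
  {C : SimpleOdCover K m} {φ : G → H} {P : K → G} {L : Set K → Δ.Label} {c : G → Fin m × ℕ}
  {k : Fin m → ℕ}

lemma exists_map_of_labels (hΔ : Δ.IsGraph)
    (hL : ∀ a s, s ≤ C.μ a → ∀ κ ∈ C.U a s, φ (P κ) ∈ Δ.star (L (C.U a s)))
    (hk : ∀ a, k a = numChanges (C.armLabel L a) (C.μ a) + 1) :
    ∃ f : StdOd m k → H, IsSimplicialMap (StdOd.graph k) Δ f ∧ ∀ a s, s ≤ C.μ a →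
      f (StdOd.pt k a (numChanges (C.armLabel L a) s : ℕ)) =
        lastVertex (C.armLabel L a) s := by
  have hF : ∀ a, ∃ F : ℕ → H,
      (∀ s ≤ C.μ a, F (numChanges (C.armLabel L a) s) = lastVertex (C.armLabel L a) s) ∧
      (∀ r, F r ∈ Δ.verts) ∧ ∀ r, F r = F (r + 1) ∨ Δ.Adj (F r) (F (r + 1)) := by
    refine fun a => exists_compression hΔ (fun s hs => ?_) fun s hs => ?_
    · obtain ⟨κ, hκ⟩ := C.nonempty hs
      exact ⟨_, hL a s hs κ hκ⟩
    · obtain ⟨κ, hκ⟩ := (C.inter_iff a s a (s + 1) hs.le hs).2 (Or.inl ⟨rfl, by omega⟩)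
      exact ⟨_, hL a s hs.le κ hκ.1, hL a (s + 1) hs κ hκ.2⟩
  choose F hFs hFv hFa using hF
  have h0 : ∀ a b, F a 0 = F b 0 := fun a b => by
    have h := fun a => hFs a 0 (Nat.zero_le _)
    simp only [numChanges, lastVertex, SimpleOdCover.armLabel_zero] at h
    rw [h, h]
  have hgv : ∀ x : StdOd m k, ∃ y ∈ Δ.verts, ∀ a j, j ≤ k a → x = StdOd.pt k a (j : ℕ) →
      y = F a j := by
    intro x
    by_cases hx : x ∈ (StdOd.graph k).verts
    · obtain ⟨a, j, hj, rfl⟩ := StdOd.mem_verts.1 hx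
      refine ⟨F a j, hFv a j, fun b i hi h => ?_⟩
      rcases (StdOd.pt_nat_eq_iff hj hi).1 h with ⟨rfl, rfl⟩ | ⟨rfl, rfl⟩
      exacts [h0 a b, rfl]
    · obtain ⟨a, -⟩ := StdOd.exists_pt x
      exact ⟨F a 0, hFv a 0, fun b j hj h => (hx (h ▸ StdOd.pt_mem_verts hj)).elim⟩
  choose gv hgv hgF using hgv
  have hkm : ∀ a, 1 ≤ k a := fun a => by rw [hk]; omega
  obtain ⟨f, hf, hfv⟩ := (StdOd.isGraph hkm).exists_isSimplicialMap hΔ gv (fun v _ => hgv v)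
    fun e => by
      obtain ⟨a, j, hj, he⟩ := StdOd.exists_edge_eq e
      rw [hgF _ a j (by omega) (by rw [he]; simp), hgF _ a (j + 1) hj (by rw [he]; simp)]
      exact hFa a j
  refine ⟨f, hf, fun a s hs => ?_⟩
  have hs' : numChanges (C.armLabel L a) s ≤ k a := by
    have := numChanges_mono (C.armLabel L a) hs
    rw [hk]; omega
  rw [hfv _ (StdOd.pt_mem_verts hs'), hgF _ a _ hs' rfl, hFs a s hs]

variable [MetricSpace G] {Γ : GraphData G}

lemma pt_numChanges_adj (hΔ : Δ.IsGraph) (hP : Function.Surjective P)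
    (hL : ∀ a s, s ≤ C.μ a → ∀ κ ∈ C.U a s, φ (P κ) ∈ Δ.star (L (C.U a s)))
    (hc : ∀ x, (c x).2 ≤ C.μ (c x).1 ∧ ∃ V, IsOpen V ∧ x ∈ V ∧ P ⁻¹' V ⊆ C.U (c x).1 (c x).2)
    (hk : ∀ a, k a = numChanges (C.armLabel L a) (C.μ a) + 1)
    {γ : ℝ → G} (hγ : ContinuousOn γ (Set.Icc 0 1)) {e : Fin Δ.nE}
    (he : ∀ t ∈ Set.Icc (0 : ℝ) 1, φ (γ t) = Δ.edge e t) :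
    (StdOd.graph k).Adj
      (StdOd.pt k (c (γ 0)).1 (numChanges (C.armLabel L (c (γ 0)).1) (c (γ 0)).2 : ℕ))
      (StdOd.pt k (c (γ 1)).1 (numChanges (C.armLabel L (c (γ 1)).1) (c (γ 1)).2 : ℕ)) := by
  have hstar : ∀ x, φ x ∈ Δ.star (C.armLabel L (c x).1 (c x).2) := fun x => by
    obtain ⟨hx, V, -, hxV, hPV⟩ := hc x
    obtain ⟨κ, rfl⟩ := hP x
    exact hL _ _ hx κ (hPV hxV)
  have hstar' : ∀ t ∈ Set.Icc (0 : ℝ) 1,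
      Δ.edge e t ∈ Δ.star (C.armLabel L (c (γ t)).1 (c (γ t)).2) := fun t ht =>
    he t ht ▸ hstar _
  have hub : ∀ (A : H) (p q : ℝ), p ≤ q → Set.Icc p q ⊆ Set.Icc 0 1 →
      (∀ t ∈ Set.Icc p q, C.armLabel L (c (γ t)).1 (c (γ t)).2 = Sum.inl A ∨
        ∃ r, C.armLabel L (c (γ t)).1 (c (γ t)).2 = Sum.inr r ∧ Δ.nearest (Sum.inr r) = A) →
      StdOd.pt k (c (γ p)).1 (currentOrNext (C.armLabel L (c (γ p)).1) A (c (γ p)).2 : ℕ) =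
      StdOd.pt k (c (γ q)).1 (currentOrNext (C.armLabel L (c (γ q)).1) A (c (γ q)).2 : ℕ) := by
    intro A p q hpq hsub hQ
    refine SimpleOdCover.eq_along_path hP hc
      (f := fun a s => StdOd.pt k a (currentOrNext (C.armLabel L a) A s : ℕ))
      (Q := fun S => L S = Sum.inl A ∨ ∃ r, L S = Sum.inr r ∧ Δ.nearest (Sum.inr r) = A)
      (fun h a b => ?_) (fun a s _ _ h => ?_) hpq (hγ.mono hsub) hQ
    · have h' : Δ.nearest (L C.U₀) = A := by
        rcases h with h | ⟨r, h, h'⟩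
        · rw [h]; rfl
        · rw [h, h']
      simp only [currentOrNext, lastVertex, SimpleOdCover.armLabel_zero, h', if_true, numChanges,
        Nat.cast_zero]
      exact StdOd.pt_zero a b
    · rw [currentOrNext_succ (h.imp_right fun ⟨r, h, _⟩ => ⟨r, h⟩)]
  have h1 := hub (Δ.edge e 0) 0 (1 / 3) (by norm_num) (Set.Icc_subset_Icc_right (by norm_num))
    fun t ht => by
      have ht' : t ∈ Set.Icc (0 : ℝ) 1 := ⟨ht.1, by linarith [ht.2]⟩
      exact (eq_of_mem_star_of_le ht' (hstar' t ht') ht.2).imp_right fun h => ⟨_, h, rfl⟩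
  have h2 := hub (Δ.edge e 1) (2 / 3) 1 (by norm_num) (Set.Icc_subset_Icc_left (by norm_num))
    fun t ht => by
      have ht' : t ∈ Set.Icc (0 : ℝ) 1 := ⟨by linarith [ht.1], ht.2⟩
      exact (eq_of_mem_star_of_ge ht' (hstar' t ht') ht.1).imp_right fun h => ⟨_, h, rfl⟩
  have hsub : Set.Icc (1 / 3 : ℝ) (2 / 3) ⊆ Set.Icc 0 1 :=
    Set.Icc_subset_Icc (by norm_num) (by norm_num)
  have hmid : ∀ t ∈ Set.Icc (1 / 3 : ℝ) (2 / 3), ∃ r,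
      L (C.U (c (γ t)).1 (c (γ t)).2) = Sum.inr r :=
    fun t ht => let ⟨b, h⟩ := eq_of_mem_star_middle (hstar' t (hsub ht)) ht; ⟨_, h⟩
  have h3 := SimpleOdCover.eq_along_path hP hc
    (f := fun a s => StdOd.pt k a (numChanges (C.armLabel L a) s : ℕ))
    (Q := fun S => ∃ r, L S = Sum.inr r)
    (fun _ a b => by simpa [numChanges] using StdOd.pt_zero a b)
    (fun a s _ _ ⟨r, h⟩ => by
      rw [numChanges_of_eq (lastVertex_inr (lab := C.armLabel L a) h)])
    (by norm_num : (1 / 3 : ℝ) ≤ 2 / 3) (hγ.mono hsub) hmid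
  have h4 := SimpleOdCover.eq_along_path hP hc
    (f := fun a s => lastVertex (C.armLabel L a) s) (Q := fun S => ∃ r, L S = Sum.inr r)
    (fun _ a b => by simp [lastVertex, SimpleOdCover.armLabel_zero])
    (fun a s _ _ ⟨r, h⟩ => (lastVertex_inr (lab := C.armLabel L a) h).symm)
    (by norm_num : (1 / 3 : ℝ) ≤ 2 / 3) (hγ.mono hsub) hmid
  have hinc : ∀ t ∈ Set.Icc (1 / 3 : ℝ) (2 / 3),
      lastVertex (C.armLabel L (c (γ t)).1) (c (γ t)).2 = Δ.edge e 0 ∨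
      lastVertex (C.armLabel L (c (γ t)).1) (c (γ t)).2 = Δ.edge e 1 := by
    intro t ht
    obtain ⟨b, h⟩ := eq_of_mem_star_middle (hstar' t (hsub ht)) ht
    refine lastVertex_incident hΔ (M := C.μ (c (γ t)).1) (fun s hs => ?_) (hc _).1 h
    obtain ⟨κ, hκ⟩ := (C.inter_iff _ s (c (γ t)).1 (s + 1) hs.le hs).2 (Or.inl ⟨rfl, by omega⟩)
    exact ⟨_, hL _ s hs.le κ hκ.1, hL _ (s + 1) hs κ hκ.2⟩
  have hv0 : lastVertex (C.armLabel L (c (γ 0)).1) (c (γ 0)).2 = Δ.edge e 0 := by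
    refine lastVertex_inl (hΔ.eq_inl_of_mem_star (hΔ.2.2.1 e) (hstar' 0 (by simp)))
  have hv1 : lastVertex (C.armLabel L (c (γ 1)).1) (c (γ 1)).2 = Δ.edge e 1 := by
    refine lastVertex_inl (hΔ.eq_inl_of_mem_star (hΔ.2.2.2.1 e) (hstar' 1 (by simp)))
  have hlt : ∀ x, numChanges (C.armLabel L (c x).1) (c x).2 + 1 ≤ k (c x).1 := fun x => by
    have := numChanges_mono (C.armLabel L (c x).1) (hc x).1
    rw [hk]; omega
  have hne := hΔ.2.2.2.2.1 e
  have m1 : (1 / 3 : ℝ) ∈ Set.Icc (1 / 3 : ℝ) (2 / 3) := by constructor <;> norm_num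
  rw [currentOrNext, if_pos hv0] at h1
  rw [currentOrNext, currentOrNext, if_pos hv1] at h2
  rw [currentOrNext] at h1
  rw [h1, ← h2, StdOd.adj_iff]
  rcases hinc _ m1 with h | h
  · rw [if_pos h, if_neg (by rw [← h4, h]; exact hne), h3]
    exact ⟨_, _, hlt _, rfl⟩
  · rw [if_neg (by rw [h]; exact hne.symm), if_pos (by rw [← h4, h]), ← h3]
    exact ⟨_, _, hlt _, Set.pair_comm _ _⟩

lemma exists_factorization (hΓ : Γ.IsGraph) (hΔ : Δ.IsGraph) (hφ : IsSimplicialMap Γ Δ φ)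
    (hP : Function.Surjective P)
    (hL : ∀ a s, s ≤ C.μ a → ∀ κ ∈ C.U a s, φ (P κ) ∈ Δ.star (L (C.U a s)))
    (hc : ∀ x, (c x).2 ≤ C.μ (c x).1 ∧
      ∃ V, IsOpen V ∧ x ∈ V ∧ P ⁻¹' V ⊆ C.U (c x).1 (c x).2) :
    ∃ k : Fin m → ℕ, (∀ a, 1 ≤ k a) ∧ ∃ (g : G → StdOd m k) (f : StdOd m k → H),
      IsSimplicialMap Γ (StdOd.graph k) g ∧ IsSimplicialMap (StdOd.graph k) Δ f ∧
      ∀ x, f (g x) = φ x := by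
  obtain ⟨k, hk⟩ : ∃ k : Fin m → ℕ, ∀ a, k a = numChanges (C.armLabel L a) (C.μ a) + 1 :=
    ⟨_, fun _ => rfl⟩
  have hk1 : ∀ a, 1 ≤ k a := fun a => by rw [hk]; omega
  obtain ⟨f, hf, hfq⟩ := exists_map_of_labels hΔ hL hk
  have hstar : ∀ x, φ x ∈ Δ.star (C.armLabel L (c x).1 (c x).2) := fun x => by
    obtain ⟨hx, V, -, hxV, hPV⟩ := hc x
    obtain ⟨κ, rfl⟩ := hP x
    exact hL _ _ hx κ (hPV hxV)
  have hle : ∀ x, numChanges (C.armLabel L (c x).1) (c x).2 ≤ k (c x).1 := fun x => by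
    have := numChanges_mono (C.armLabel L (c x).1) (hc x).1
    rw [hk]; omega
  obtain ⟨g, hg, hgv⟩ := hΓ.exists_isSimplicialMap (StdOd.isGraph hk1)
    (fun x => StdOd.pt k (c x).1 (numChanges (C.armLabel L (c x).1) (c x).2 : ℕ))
    (fun v _ => StdOd.pt_mem_verts (hle v)) fun e => by
      rcases hφ.2.2 e with ⟨w, hw, h⟩ | ⟨e', h | h⟩
      · left
        have hlab : ∀ t ∈ Set.Icc (0 : ℝ) 1,
            L (C.U (c (Γ.edge e t)).1 (c (Γ.edge e t)).2) = Sum.inl w := fun t ht =>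
          hΔ.eq_inl_of_mem_star hw (h t ht ▸ hstar _)
        refine SimpleOdCover.eq_along_path hP hc
          (f := fun a s => StdOd.pt k a (numChanges (C.armLabel L a) s : ℕ))
          (Q := fun S => L S = Sum.inl w)
          (fun _ a b => by simpa [numChanges] using StdOd.pt_zero a b) (fun a s _ h h' => ?_)
          zero_le_one (hΓ.1 e) hlab
        rw [numChanges_of_eq ((lastVertex_inl (lab := C.armLabel L a) h').trans
          (lastVertex_inl (lab := C.armLabel L a) h).symm)]
      · exact Or.inr (pt_numChanges_adj hΔ hP hL hc hk (hΓ.1 e) h)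
      · right
        have hmaps : Set.MapsTo (fun t : ℝ => 1 - t) (Set.Icc 0 1) (Set.Icc 0 1) := fun t ht =>
          ⟨by linarith [ht.2], by linarith [ht.1]⟩
        have := pt_numChanges_adj hΔ hP hL hc hk (γ := fun t => Γ.edge e (1 - t)) (e := e')
          ((hΓ.1 e).comp (by fun_prop) hmaps)
          fun t ht => by rw [h _ (hmaps ht), sub_sub_cancel]
        simp only [sub_zero, sub_self] at this
        exact this.symm
  refine ⟨k, hk1, g, f, hg, hf, (hf.comp hg).eq_of_eqOn_verts hΓ hΔ hφ fun v hv => ?_⟩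
  rw [Function.comp_apply, hgv v hv, hfq _ _ (hc v).1]
  exact lastVertex_inl (hΔ.eq_inl_of_mem_star (hφ.2.1 v hv) (hstar v))

end Factor

/-! ## Inverse sequences -/

section InverseSequence

variable {X : ℕ → Type*} (Φ : ∀ i, X (i + 1) → X i)

/-- The composite bonding map `X j → X i` of an inverse sequence, for `i ≤ j`. -/
def bond {i j : ℕ} (h : i ≤ j) : X j → X i :=
  Nat.leRecOn (C := fun j => X j → X i) h (fun {j} f => f ∘ Φ j) id

lemma bond_self (i : ℕ) (x : X i) : bond Φ le_rfl x = x :=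
  congrFun (Nat.leRecOn_self (C := fun j => X j → X i) _) x

lemma bond_succ {i j : ℕ} (h : i ≤ j) (h' : i ≤ j + 1) (x : X (j + 1)) :
    bond Φ h' x = bond Φ h (Φ j x) :=
  congrFun (Nat.leRecOn_succ (C := fun j => X j → X i) h _) x

lemma apply_bond {i j : ℕ} (h : i + 1 ≤ j) (h' : i ≤ j) (x : X j) :
    Φ i (bond Φ h x) = bond Φ h' x := by
  induction j, h using Nat.le_induction with
  | base => rw [bond_self, bond_succ Φ le_rfl, bond_self]
  | succ j h ih => rw [bond_succ Φ h, bond_succ Φ (by omega : i ≤ j), ih]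

variable {Φ}

lemma bond_apply_of_compatible {x : ∀ i, X i} (hx : ∀ i, Φ i (x (i + 1)) = x i) {i j : ℕ}
    (h : i ≤ j) : bond Φ h (x j) = x i := by
  induction j, h using Nat.le_induction with
  | base => exact bond_self Φ i _
  | succ j h ih => rw [bond_succ Φ h, hx, ih]

lemma exists_compatible (hΦ : ∀ i, Function.Surjective (Φ i)) (j : ℕ) (y : X j) :
    ∃ x : ∀ i, X i, (∀ i, Φ i (x (i + 1)) = x i) ∧ x j = y := by
  choose σ hσ using hΦ
  let u : ∀ l, X (j + l) := fun l => Nat.rec y (fun l x => σ (j + l) x) l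
  have hu : ∀ l, Φ (j + l) (u (l + 1)) = u l := fun l => hσ _ _
  have hbond : ∀ l, bond Φ (Nat.le_add_right j l) (u l) = y := by
    intro l
    induction l with
    | zero => exact bond_self Φ j y
    | succ l ih => exact (bond_succ Φ (Nat.le_add_right j l) _ _).trans ((hu l).symm ▸ ih)
  refine ⟨fun l => bond Φ (Nat.le_add_left l j) (u l), fun l => ?_, hbond j⟩
  rw [apply_bond Φ _ (by omega)]
  exact (bond_succ Φ (Nat.le_add_left l j) _ _).trans (by rw [hu l])

lemma continuous_bond [∀ i, TopologicalSpace (X i)] (hΦ : ∀ i, Continuous (Φ i)) {i j : ℕ}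
    (h : i ≤ j) : Continuous (bond Φ h) := by
  induction j, h using Nat.le_induction with
  | base =>
    rw [show bond Φ le_rfl = id from funext (bond_self Φ i)]
    exact continuous_id
  | succ j h ih =>
    rw [show bond Φ (h.trans (Nat.le_succ j)) = bond Φ h ∘ Φ j from funext (bond_succ Φ h _)]
    exact ih.comp (hΦ j)

lemma isSimplicialMap_bond [∀ i, TopologicalSpace (X i)] {Γ : ∀ i, GraphData (X i)}
    (hΦ : ∀ i, IsSimplicialMap (Γ (i + 1)) (Γ i) (Φ i)) {i j : ℕ} (h : i ≤ j) :
    IsSimplicialMap (Γ j) (Γ i) (bond Φ h) := by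
  induction j, h using Nat.le_induction with
  | base =>
    rw [show bond Φ le_rfl = id from funext (bond_self Φ i)]
    exact IsSimplicialMap.id _
  | succ j h ih =>
    rw [show bond Φ (h.trans (Nat.le_succ j)) = bond Φ h ∘ Φ j from funext (bond_succ Φ h _)]
    exact ih.comp (hΦ j)

/-- Every open subset of an inverse limit containing a point contains a basic neighbourhood of
it, coming from a single factor. -/
lemma InvLimit.exists_isOpen_factor [∀ i, TopologicalSpace (X i)]
    (hΦ : ∀ i, Continuous (Φ i)) {W : Set (InvLimit Φ)} (hW : IsOpen W) {x : InvLimit Φ}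
    (hx : x ∈ W) : ∃ j, ∃ V : Set (X j), IsOpen V ∧ x.1 j ∈ V ∧
      ∀ z : InvLimit Φ, z.1 j ∈ V → z ∈ W := by
  obtain ⟨O, hO, rfl⟩ := isOpen_induced_iff.1 hW
  obtain ⟨I, u, hu, hI⟩ := isOpen_pi_iff.1 hO x.1 hx
  have hle : ∀ i ∈ I, i ≤ I.sup id := fun i hi => Finset.le_sup (f := id) hi
  refine ⟨I.sup id, ⋂ i ∈ I, if h : i ≤ I.sup id then bond Φ h ⁻¹' u i else Set.univ,
    isOpen_biInter_finset fun i hi => ?_, ?_, fun z hz => ?_⟩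
  · rw [dif_pos (hle i hi)]
    exact (hu i hi).1.preimage (continuous_bond hΦ _)
  · refine Set.mem_iInter₂.2 fun i hi => ?_
    rw [dif_pos (hle i hi), Set.mem_preimage, bond_apply_of_compatible x.2]
    exact (hu i hi).2
  · refine hI fun i hi => ?_
    have h := Set.mem_iInter₂.1 hz i hi
    rwa [dif_pos (hle i hi), Set.mem_preimage,
      bond_apply_of_compatible z.2] at h

instance [∀ i, TopologicalSpace (X i)] [∀ i, T2Space (X i)] : T2Space (InvLimit Φ) :=
  inferInstanceAs (T2Space {x : ∀ i, X i // ∀ i, Φ i (x (i + 1)) = x i})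

lemma InvLimit.continuous_apply [∀ i, TopologicalSpace (X i)] (j : ℕ) :
    Continuous fun x : InvLimit Φ => x.1 j :=
  (_root_.continuous_apply j).comp continuous_subtype_val

end InverseSequence

/-- For every finite simple-od cover of a compact inverse limit, all sufficiently late projections
are finer than the cover. -/
lemma SimpleOdCover.exists_fine_projection {K : Type*} [MetricSpace K] [CompactSpace K]
    {X : ℕ → Type*} [∀ i, TopologicalSpace (X i)] {Φ : ∀ i, X (i + 1) → X i}
    (hΦ : ∀ i, Continuous (Φ i)) (hΦsurj : ∀ i, Function.Surjective (Φ i))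
    (h : K ≃ₜ InvLimit Φ) {m : ℕ} (hm : 0 < m) (C : SimpleOdCover K m) (i : ℕ) :
    ∃ j, i < j ∧ ∃ c : X j → Fin m × ℕ, ∀ x, (c x).2 ≤ C.μ (c x).1 ∧
      ∃ V, IsOpen V ∧ x ∈ V ∧ (fun κ => (h κ).1 j) ⁻¹' V ⊆ C.U (c x).1 (c x).2 := by
  have hloc : ∀ κ : K, ∃ a s, s ≤ C.μ a ∧ ∃ j, ∃ V : Set (X j), IsOpen V ∧ (h κ).1 j ∈ V ∧
      ∀ κ', (h κ').1 j ∈ V → κ' ∈ C.U a s := by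
    intro κ
    obtain ⟨a, s, hs, hκ⟩ := C.exists_mem hm κ
    obtain ⟨j, V, hV, hκV, hVU⟩ := InvLimit.exists_isOpen_factor hΦ
      ((C.isOpen hs).preimage h.symm.continuous) (x := h κ) (by simpa using hκ)
    exact ⟨a, s, hs, j, V, hV, hκV, fun κ' hκ' => by simpa using hVU _ hκ'⟩
  choose a s hs j V hV hκV hVU using hloc
  obtain ⟨t, ht⟩ := CompactSpace.elim_nhds_subcover (fun κ => (fun κ' => (h κ').1 (j κ)) ⁻¹' V κ)
    fun κ => ((hV κ).preimage ((InvLimit.continuous_apply _).comp h.continuous)).mem_nhds (hκV κ)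
  refine ⟨max (i + 1) (t.sup j), by omega, ?_⟩
  suffices ∀ x : X (max (i + 1) (t.sup j)), ∃ z : Fin m × ℕ, z.2 ≤ C.μ z.1 ∧
      ∃ V, IsOpen V ∧ x ∈ V ∧ (fun κ => (h κ).1 _) ⁻¹' V ⊆ C.U z.1 z.2 from
    ⟨_, fun x => (this x).choose_spec⟩
  intro x
  obtain ⟨y, hy, rfl⟩ := exists_compatible hΦsurj _ x
  obtain ⟨κ, hκ⟩ := h.surjective ⟨y, hy⟩
  have hmem : κ ∈ ⋃ κ₀ ∈ t, (fun κ' => (h κ').1 (j κ₀)) ⁻¹' V κ₀ := by rw [ht]; trivial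
  obtain ⟨κ₀, hκ₀, hκV'⟩ := Set.mem_iUnion₂.1 hmem
  have hle : j κ₀ ≤ max (i + 1) (t.sup j) := (Finset.le_sup hκ₀).trans (le_max_right _ _)
  refine ⟨(a κ₀, s κ₀), hs κ₀, bond Φ hle ⁻¹' V κ₀, (hV κ₀).preimage (continuous_bond hΦ hle), ?_,
    fun κ' hκ' => hVU κ₀ κ' ?_⟩
  · rw [Set.mem_preimage, bond_apply_of_compatible hy]
    simpa [hκ] using hκV'
  · rwa [Set.mem_preimage, Set.mem_preimage, bond_apply_of_compatible (h κ').2] at hκ'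

/-- Intertwining an inverse sequence with another one yields homeomorphic inverse limits. -/
lemma nonempty_homeomorph_invLimit {K : Type*} [TopologicalSpace K] [CompactSpace K]
    {X Y : ℕ → Type*} [∀ i, TopologicalSpace (X i)] [∀ i, T2Space (X i)]
    [∀ i, TopologicalSpace (Y i)] [∀ i, T2Space (Y i)] {p : ∀ i, K → X i}
    (hp : ∀ i, Continuous (p i)) (hps : ∀ i, Function.Surjective (p i))
    (hpi : ∀ κ κ', (∀ i, p i κ = p i κ') → κ = κ') {g : ∀ i, X (i + 1) → Y i} {f : ∀ i, Y i → X i}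
    (hg : ∀ i, Continuous (g i)) (hfg : ∀ i κ, f i (g i (p (i + 1) κ)) = p i κ) :
    Nonempty (K ≃ₜ InvLimit fun i => g i ∘ f (i + 1)) := by
  let F : K → InvLimit fun i => g i ∘ f (i + 1) := fun κ =>
    ⟨fun i => g i (p (i + 1) κ), fun i => congrArg (g i) (hfg (i + 1) κ)⟩
  have hF : Continuous F := Continuous.subtype_mk
    (continuous_pi fun i => (hg i).comp (hp (i + 1))) _
  have hinj : Function.Injective F := fun κ κ' h => hpi _ _ fun i => by
    have h' : g i (p (i + 1) κ) = g i (p (i + 1) κ') := congrFun (congrArg Subtype.val h) i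
    rw [← hfg, h', hfg]
  have hsurj : Function.Surjective F := by
    intro y
    have hcl : ∀ i, IsClosed {κ | p i κ = f i (y.1 i)} := fun i =>
      isClosed_eq (hp i) continuous_const
    have hy : ∀ i κ, p (i + 1) κ = f (i + 1) (y.1 (i + 1)) → g i (p (i + 1) κ) = y.1 i :=
      fun i κ h => by rw [h]; exact y.2 i
    obtain ⟨κ, hκ⟩ := IsCompact.nonempty_iInter_of_sequence_nonempty_isCompact_isClosed
      (fun i => {κ | p i κ = f i (y.1 i)})
      (fun i κ (h : p (i + 1) κ = _) => show p i κ = _ by rw [← hy i κ h, hfg])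
      (fun i => hps i _) (hcl 0).isCompact hcl
    exact ⟨κ, Subtype.ext (funext fun i => hy i κ (Set.mem_iInter.1 hκ (i + 1)))⟩
  exact ⟨Continuous.homeoOfEquivCompactToT2 (f := Equiv.ofBijective F ⟨hinj, hsurj⟩) hF⟩

/-- Let `n ≥ 3` and let `K` be a continuum homeomorphic to the inverse
limit of simple-`n`-od graphs with surjective simplicial bonding maps.  If `K` is
simple-`(n-1)`-od-like in the covering sense, then `K` is homeomorphic to an inverse
limit of simple-`n' i`-od graphs (`1 ≤ n' i ≤ n - 1`) with simplicial bonding maps. -/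
theorem statement3 {K : Type*} [MetricSpace K] [CompactSpace K] [ConnectedSpace K]
    [Nonempty K] (n : ℕ) (hn : 3 ≤ n)
    (X : ℕ → Type) [∀ i, MetricSpace (X i)] [∀ i, CompactSpace (X i)]
    [∀ i, ConnectedSpace (X i)] [∀ i, Nonempty (X i)]
    (Γ : ∀ i, GraphData (X i)) (x₀ : ∀ i, X i)
    (hΓ : ∀ i, IsSimpleOdGraphData (Γ i) n (x₀ i))
    (Φ : ∀ i, X (i + 1) → X i)
    (hΦ : ∀ i, IsSimplicialMap (Γ (i + 1)) (Γ i) (Φ i))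
    (hΦsurj : ∀ i, Function.Surjective (Φ i))
    (hK : Nonempty (K ≃ₜ InvLimit Φ))
    (hlike : SimpleOdLikeCov K (n - 1)) :
    ∃ (Y : ℕ → Type) (_ : ∀ i, MetricSpace (Y i)),
      (∀ i, CompactSpace (Y i)) ∧ (∀ i, ConnectedSpace (Y i)) ∧
      ∃ (ΔY : ∀ i, GraphData (Y i)) (n' : ℕ → ℕ) (y₀ : ∀ i, Y i)
        (Ψ : ∀ i, Y (i + 1) → Y i),
        (∀ i, 1 ≤ n' i ∧ n' i ≤ n - 1) ∧
        (∀ i, IsSimpleOdGraphData (ΔY i) (n' i) (y₀ i)) ∧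
        (∀ i, IsSimplicialMap (ΔY (i + 1)) (ΔY i) (Ψ i)) ∧
        Nonempty (K ≃ₜ InvLimit Ψ) := by
  obtain ⟨h⟩ := hK
  have hm : 0 < n - 1 := by omega
  have hG : ∀ i, (Γ i).IsGraph := fun i => let ⟨_, _, h⟩ := hΓ i; h.1
  have hps : ∀ i, Function.Surjective fun κ => (h κ).1 i := fun i x => by
    obtain ⟨y, hy, rfl⟩ := exists_compatible hΦsurj i x
    obtain ⟨κ, hκ⟩ := h.surjective ⟨y, hy⟩
    exact ⟨κ, by simp only [hκ]⟩
  have hpc : ∀ i, Continuous fun κ => (h κ).1 i := fun i =>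
    (InvLimit.continuous_apply i).comp h.continuous
  have key : ∀ i, ∃ j, i < j ∧ ∃ k : Fin (n - 1) → ℕ, (∀ a, 1 ≤ k a) ∧
      ∃ (g : X j → StdOd (n - 1) k) (f : StdOd (n - 1) k → X i),
        IsSimplicialMap (Γ j) (StdOd.graph k) g ∧ IsSimplicialMap (StdOd.graph k) (Γ i) f ∧
        ∀ κ, f (g ((h κ).1 j)) = (h κ).1 i := by
    intro i
    obtain ⟨ε, hε, hball⟩ := lebesgue_number_lemma_of_metric (isCompact_univ (X := K))
      (fun l => ((hG i).isOpen_star l).preimage (hpc i))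
      fun κ _ => Set.mem_iUnion.2 ((hG i).exists_mem_star _)
    obtain ⟨C, hC⟩ := hlike ε hε
    have hlab : ∀ S : Set K, ∃ l, (S.Nonempty → Metric.diam S < ε →
        ∀ κ ∈ S, (h κ).1 i ∈ (Γ i).star l) := by
      intro S
      by_cases hS : S.Nonempty
      · obtain ⟨κ₀, hκ₀⟩ := hS
        obtain ⟨l, hl⟩ := hball κ₀ trivial
        refine ⟨l, fun _ hd κ hκ => hl (Metric.mem_ball.2 ?_)⟩
        exact (Metric.dist_le_diam_of_mem Metric.isBounded_of_compactSpace hκ hκ₀).trans_lt hd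
      · exact ⟨Sum.inl (x₀ i), fun h => (hS h).elim⟩
    choose L hL using hlab
    obtain ⟨j, hij, c, hc⟩ := C.exists_fine_projection (fun i => (hΦ i).1) hΦsurj h hm i
    have hdiam : ∀ a s, s ≤ C.μ a → Metric.diam (C.U a s) < ε := fun a s hs => by
      rcases Nat.eq_zero_or_pos s with rfl | hs'
      · rw [C.base]; exact hC.1
      · exact hC.2 a s hs' hs
    obtain ⟨k, hk, g, f, hg, hf, hfg⟩ := exists_factorization (L := L) (hG j) (hG i)
      (isSimplicialMap_bond hΦ hij.le) (hps j)
      (fun a s hs κ hκ => by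
        rw [bond_apply_of_compatible (h κ).2]
        exact hL _ (C.nonempty hs) (hdiam a s hs) κ hκ) hc
    exact ⟨j, hij, k, hk, g, f, hg, hf, fun κ => by
      rw [hfg, bond_apply_of_compatible (h κ).2]⟩
  choose J hJ k hk g f hg hf hfg using key
  let I : ℕ → ℕ := fun i => Nat.rec 0 (fun _ j => J j) i
  have hI : ∀ i, i ≤ I i := fun i => by
    induction i with
    | zero => exact Nat.zero_le _
    | succ i ih => exact ih.trans_lt (hJ (I i))
  refine ⟨fun i => StdOd (n - 1) (k (I i)), fun i => inferInstance,
    fun i => StdOd.compactSpace hm, fun i => StdOd.connectedSpace hm,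
    fun i => StdOd.graph (k (I i)), fun _ => n - 1, fun i => StdOd.pt _ ⟨0, hm⟩ 0,
    fun i => g (I i) ∘ f (I (i + 1)), fun i => ⟨hm, le_rfl⟩,
    fun i => StdOd.isSimpleOd hm (hk _), fun i => (hg (I i)).comp (hf (I (i + 1))), ?_⟩
  refine nonempty_homeomorph_invLimit (X := fun i => X (I i)) (p := fun i κ => (h κ).1 (I i))
    (fun i => hpc _) (fun i => hps _)
    (fun κ κ' hκ => h.injective (Subtype.ext (funext fun i => ?_)))
    (g := fun i => g (I i)) (f := fun i => f (I i)) (fun i => (hg (I i)).1) fun i => hfg (I i)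
  rw [← bond_apply_of_compatible (h κ).2 (hI i), ← bond_apply_of_compatible (h κ').2 (hI i), hκ i]
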